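/- arXiv:math/0507352 — 6 statements merged into one kernel-verified Lean document; each statement's English description precedes it below -/
import Mathlib

section
/- For every natural number N with N ≥ 6 there exists a prime number p with p ≡ 1 (mod 4) such that N² is excluded by p. (Hence no perfect square greater than 25 survives Euler's exclusion procedure, so no square greater than 25 is an idoneal number.) -/
/-- Euler's exclusion rule: a natural number `s` is *excluded by* the prime `p` if
(i) `4 * s > p ^ 2`,
(ii) there exist integers `x`, `y` with `p ∤ y` and `(s : ℤ) = p * x - y ^ 2`, and
(iii) there is no integer `y` with `(s : ℤ) = p ^ 2 - y ^ 2`. -/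
def ExcludedBy (p s : ℕ) : Prop :=
  4 * s > p ^ 2 ∧
  (∃ x y : ℤ, ¬ (p : ℤ) ∣ y ∧ (s : ℤ) = p * x - y ^ 2) ∧
  ¬ ∃ y : ℤ, (s : ℤ) = (p : ℤ) ^ 2 - y ^ 2

/-- A square `N ^ 2` is excluded by every prime `p ≡ 1 (mod 4)` below `N` not dividing `N`. -/
lemma ExcludedBy.sq_of_lt {p N : ℕ} (hp : p.Prime) (hp4 : p % 4 = 1) (hlt : p < N)
    (hdvd : ¬ p ∣ N) : ExcludedBy p (N ^ 2) := by
  have : Fact p.Prime := ⟨hp⟩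
  refine ⟨by nlinarith, ?_, ?_⟩
  · obtain ⟨i, hi⟩ := ZMod.exists_sq_eq_neg_one_iff.mpr (show p % 4 ≠ 3 by omega)
    have hN0 : (N : ZMod p) ≠ 0 := by rwa [Ne, ZMod.natCast_eq_zero_iff]
    have hi0 : i ≠ 0 := by
      rintro rfl
      simp at hi
    obtain ⟨y, hy⟩ := ZMod.intCast_surjective ((N : ZMod p) * i)
    have hx : (p : ℤ) ∣ (N : ℤ) ^ 2 + y ^ 2 := by
      rw [← ZMod.intCast_zmod_eq_zero_iff_dvd _ p]
      push_cast
      rw [hy]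
      linear_combination (-(N : ZMod p) ^ 2) * hi
    obtain ⟨x, hx⟩ := hx
    refine ⟨x, y, fun h => ?_, by push_cast; linarith⟩
    rw [← ZMod.intCast_zmod_eq_zero_iff_dvd _ p, hy] at h
    exact mul_ne_zero hN0 hi0 h
  · rintro ⟨y, hy⟩
    push_cast at hy
    have : (p : ℤ) < N := by exact_mod_cast hlt
    nlinarith [sq_nonneg y]

/-- Among `1, …, M` with `M ≤ p`, at most two `t` satisfy `p ∣ (c * t) ^ 2 + 1`. -/
lemma card_filter_dvd_mul_sq_add_one_le_two {p : ℕ} (hp : p.Prime) (hp2 : p ≠ 2) (c M : ℕ)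
    (hM : M ≤ p) : ((Finset.Icc 1 M).filter (fun t => p ∣ (c * t) ^ 2 + 1)).card ≤ 2 := by
  rcases Finset.eq_empty_or_nonempty
    ((Finset.Icc 1 M).filter (fun t => p ∣ (c * t) ^ 2 + 1)) with h | ⟨s, hs⟩
  · simp [h]
  refine (Finset.card_le_card (t := {s, p - s}) ?_).trans Finset.card_le_two
  intro t ht
  simp only [Finset.mem_filter, Finset.mem_Icc] at hs ht
  have key : ∀ u : ℕ, p ∣ (c * u) ^ 2 + 1 → ¬ p ∣ c * u := fun u hu h =>
    hp.one_lt.ne' (Nat.dvd_one.mp ((Nat.dvd_add_right (dvd_pow h two_ne_zero)).mp hu))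
  have hc : ¬ (p : ℤ) ∣ c := by
    rw [Int.natCast_dvd_natCast]
    exact fun h => key s hs.2 (h.mul_right s)
  have hsp : s ≠ p := by
    rintro rfl
    exact key s hs.2 (dvd_mul_left s c)
  have hp' := Nat.prime_iff_prime_int.mp hp
  have h1 : (p : ℤ) ∣ (c : ℤ) ^ 2 * (((t : ℤ) - s) * (t + s)) := by
    have := dvd_sub (Int.natCast_dvd_natCast.mpr ht.2) (Int.natCast_dvd_natCast.mpr hs.2)
    push_cast at this
    rwa [show (c : ℤ) ^ 2 * (((t : ℤ) - s) * (t + s)) =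
      (c * t) ^ 2 + 1 - ((c * s) ^ 2 + 1) by ring]
  have h2 := (hp'.dvd_or_dvd h1).resolve_left (fun h => hc (hp'.dvd_of_dvd_pow h))
  simp only [Finset.mem_insert, Finset.mem_singleton]
  rcases hp'.dvd_or_dvd h2 with h | h
  · left
    have := Int.eq_zero_of_abs_lt_dvd h (by rw [abs_lt]; constructor <;> omega)
    omega
  · right
    obtain ⟨k, hk⟩ := h
    have hk0 : 0 < k := by
      by_contra! hk'
      nlinarith
    have hk2 : k < 2 := by
      by_contra! hk'
      nlinarith [show s < p by omega]
    obtain rfl : k = 1 := by omega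
    omega

/-- A set of `k ≥ 5` primes congruent to `1` modulo `4` has few members below `2 * k + 1`. -/
lemma two_mul_card_filter_lt_add_three_le {S : Finset ℕ}
    (hS : ∀ p ∈ S, p.Prime ∧ p % 4 = 1) (hcard : 5 ≤ S.card) :
    2 * (S.filter (fun p => p < 2 * S.card + 1)).card + 3 ≤ S.card := by
  have h : (S.filter (fun p => p < 2 * S.card + 1)).card ≤
      ((Finset.Icc 1 ((S.card - 1) / 2)).erase 2).card := by
    refine Finset.card_le_card_of_injOn (fun p => p / 4) ?_ ?_
    · intro p hp
      simp only [Finset.coe_filter, Set.mem_ofPred_eq] at hp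
      obtain ⟨hpr, h4⟩ := hS p hp.1
      have h1 : p ≠ 1 := hpr.ne_one
      have h9 : p ≠ 9 := by
        rintro rfl
        norm_num at hpr
      simp only [Finset.coe_erase, Finset.coe_Icc, Set.mem_sdiff, Set.mem_Icc,
        Set.mem_singleton_iff]
      omega
    · intro p hp q hq hpq
      simp only [Finset.coe_filter, Set.mem_ofPred_eq] at hp hq hpq
      have := (hS p hp.1).2
      have := (hS q hq.1).2
      omega
  rw [Finset.card_erase_of_mem (by simp only [Finset.mem_Icc]; omega), Nat.card_Icc] at h
  omega

/-- A Bonse-type inequality for primes congruent to `1` modulo `4`: any set of at least five such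
primes misses one that is smaller than their product. -/
lemma exists_prime_one_mod_four_notMem_lt_prod {S : Finset ℕ}
    (hS : ∀ p ∈ S, p.Prime ∧ p % 4 = 1) (hcard : 5 ≤ S.card) :
    ∃ q : ℕ, q.Prime ∧ q % 4 = 1 ∧ q ∉ S ∧ q < ∏ p ∈ S, p := by
  have hsmall := two_mul_card_filter_lt_add_three_le hS hcard
  set M := 2 * S.card + 1 with hM
  set A := S.filter (fun p => p < M)
  set B := S.filter (fun p => ¬ p < M)
  have hAB : A.card + B.card = S.card := Finset.card_filter_add_card_filter_not _
  set Q := ∏ p ∈ A, p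
  have hprod : Q * ∏ p ∈ B, p = ∏ p ∈ S, p := Finset.prod_filter_mul_prod_filter_not _ _ _
  have hQpos : 0 < Q := Finset.prod_pos fun p hp => (hS p (Finset.mem_filter.mp hp).1).1.pos
  obtain ⟨t, ht, htB⟩ : ∃ t ∈ Finset.Icc 1 M, ∀ p ∈ B, ¬ p ∣ (2 * Q * t) ^ 2 + 1 := by
    by_contra! hcon
    have hsub : Finset.Icc 1 M ⊆
        B.biUnion (fun p => (Finset.Icc 1 M).filter (fun t => p ∣ (2 * Q * t) ^ 2 + 1)) := by
      intro t ht
      obtain ⟨p, hp, hpt⟩ := hcon t ht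
      exact Finset.mem_biUnion.mpr ⟨p, hp, Finset.mem_filter.mpr ⟨ht, hpt⟩⟩
    have h1 := (Finset.card_le_card hsub).trans
      (Finset.card_biUnion_le_card_mul _ _ 2 fun p hp => by
        obtain ⟨hpS, hpM⟩ := Finset.mem_filter.mp hp
        obtain ⟨hpr, h4⟩ := hS p hpS
        exact card_filter_dvd_mul_sq_add_one_le_two hpr (by omega) _ _ (by omega))
    rw [Nat.card_Icc] at h1
    omega
  rw [Finset.mem_Icc] at ht
  have hne : (2 * Q * t) ^ 2 + 1 ≠ 1 := by
    have : 0 < (2 * Q * t) ^ 2 := by have := ht.1; positivity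
    omega
  obtain ⟨q, hq, hqd⟩ := Nat.exists_prime_and_dvd hne
  have hq1 : ∀ u, q ∣ u → ¬ q ∣ u ^ 2 + 1 := fun u hu h =>
    hq.one_lt.ne' (Nat.dvd_one.mp ((Nat.dvd_add_right (dvd_pow hu two_ne_zero)).mp h))
  have hq2 : q ≠ 2 := by
    rintro rfl
    exact hq1 (2 * Q * t) ⟨Q * t, by ring⟩ hqd
  have hq3 : q % 4 ≠ 3 := by
    have : Fact q.Prime := ⟨hq⟩
    refine ZMod.mod_four_ne_three_of_sq_eq_neg_one (y := ((2 * Q * t : ℕ) : ZMod q)) ?_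
    rw [← ZMod.natCast_eq_zero_iff] at hqd
    rw [Nat.cast_add, Nat.cast_pow, Nat.cast_one] at hqd
    exact eq_neg_of_add_eq_zero_left hqd
  have hqodd := hq.eq_two_or_odd
  refine ⟨q, hq, by omega, fun hqS => ?_, ?_⟩
  · by_cases hqM : q < M
    · have : q ∣ Q := Finset.dvd_prod_of_mem _ (Finset.mem_filter.mpr ⟨hqS, hqM⟩)
      exact hq1 (2 * Q * t) ((this.mul_left 2).mul_right t) hqd
    · exact htB q (Finset.mem_filter.mpr ⟨hqS, hqM⟩) hqd
  · have hQle : Q ≤ M ^ A.card :=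
      Finset.prod_le_pow_card _ _ _ fun p hp => (Finset.mem_filter.mp hp).2.le
    have hBge : M ^ B.card ≤ ∏ p ∈ B, p :=
      Finset.pow_card_le_prod _ _ _ fun p hp => not_lt.mp (Finset.mem_filter.mp hp).2
    have hMpos : 0 < M := by omega
    calc q ≤ (2 * Q * t) ^ 2 + 1 := Nat.le_of_dvd (by positivity) hqd
      _ ≤ (2 * Q * M) ^ 2 + 1 := by gcongr; exact ht.2
      _ ≤ (2 * Q * M) ^ 2 + (Q * M) ^ 2 := by gcongr; exact Nat.one_le_pow _ _ (by positivity)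
      _ = 5 * (Q * M ^ 2 * Q) := by ring
      _ < M * (Q * M ^ 2 * Q) := by gcongr; omega
      _ ≤ M * (Q * M ^ 2 * M ^ A.card) := by gcongr
      _ = Q * M ^ (A.card + 3) := by ring
      _ ≤ Q * M ^ B.card := by gcongr; omega
      _ ≤ Q * ∏ p ∈ B, p := by gcongr
      _ = ∏ p ∈ S, p := hprod

theorem euler_square_excluded_of_ge_six (N : ℕ) (hN : 6 ≤ N) :
    ∃ p : ℕ, p.Prime ∧ p % 4 = 1 ∧ ExcludedBy p (N ^ 2) := by
  by_cases h10 : N = 10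
  · subst h10
    refine ⟨13, by norm_num, by norm_num, by norm_num, ⟨8, 2, by norm_num, by norm_num⟩, ?_⟩
    rintro ⟨y, hy⟩
    push_cast at hy
    have h1 : -9 < y := by nlinarith
    have h2 : y < 9 := by nlinarith
    interval_cases y <;> norm_num at hy
  by_contra! hcon
  have hdvd : ∀ p, p.Prime → p % 4 = 1 → p < N → p ∣ N := fun p hp h4 hlt =>
    by_contra fun h => hcon p hp h4 (ExcludedBy.sq_of_lt hp h4 hlt h)
  have h5 := hdvd 5 (by norm_num) (by norm_num) (by omega)
  have h13 := hdvd 13 (by norm_num) (by norm_num) (by omega)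
  set S := (Finset.range N).filter (fun p => p.Prime ∧ p % 4 = 1) with hSdef
  have hS : ∀ p ∈ S, p.Prime ∧ p % 4 = 1 := fun p hp => (Finset.mem_filter.mp hp).2
  have hcard : 5 ≤ S.card := by
    have hsub : ({5, 13, 17, 29, 37} : Finset ℕ) ⊆ S := by
      intro p hp
      simp only [Finset.mem_insert, Finset.mem_singleton] at hp
      rw [hSdef, Finset.mem_filter, Finset.mem_range]
      rcases hp with rfl | rfl | rfl | rfl | rfl <;> norm_num <;> omega
    simpa using Finset.card_le_card hsub
  obtain ⟨q, hq, hq4, hqS, hlt⟩ := exists_prime_one_mod_four_notMem_lt_prod hS hcard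
  have hle : ∏ p ∈ S, p ≤ N := Nat.le_of_dvd (by omega) <|
    Finset.prod_primes_dvd N (fun p hp => (hS p hp).1.prime) fun p hp =>
      hdvd p (hS p hp).1 (hS p hp).2 (Finset.mem_range.mp (Finset.mem_filter.mp hp).1)
  exact hqS (Finset.mem_filter.mpr ⟨Finset.mem_range.mpr (by omega), hq, hq4⟩)
end

section
/- For every natural number N with 1 ≤ N ≤ 5, and for every prime number p with p ≡ 1 (mod 4), the square N² is not excluded by p. (Hence the five squares 1, 4, 9, 16, 25 survive Euler's exclusion procedure.) -/
theorem euler_small_squares_not_excluded (N : ℕ) (h1 : 1 ≤ N) (h5 : N ≤ 5)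
    (p : ℕ) (hp : p.Prime) (hp4 : p % 4 = 1) :
    ¬ ExcludedBy p (N ^ 2) := by
  rintro ⟨h, -, hne⟩
  have hlt : p < 2 * N := by nlinarith
  have hp1 := hp.one_lt
  have hp9 : p ≠ 9 := by
    rintro rfl
    norm_num at hp
  obtain rfl : p = 5 := by omega
  obtain rfl | rfl | rfl : N = 3 ∨ N = 4 ∨ N = 5 := by omega
  · exact hne ⟨4, by norm_num⟩
  · exact hne ⟨3, by norm_num⟩
  · exact hne ⟨0, by norm_num⟩
end

section
/- For every positive natural number N, the square N² is excluded by the prime 5 if and only if 5 ∤ N and N ≥ 6. (Consequently, after the exclusion for p = 5, the surviving squares are exactly 1, 4, 9, 16, 25 and the squares whose roots are divisible by 5.) -/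
theorem excludedBy_five_iff (N : ℕ) (hN : 0 < N) :
    ExcludedBy 5 (N ^ 2) ↔ ¬ 5 ∣ N ∧ 6 ≤ N := by
  constructor
  · rintro ⟨hsize, ⟨x, y, hy, hxy⟩, hrep⟩
    push_cast at hy hxy hrep
    have hndvd : ¬ 5 ∣ N := by
      rintro ⟨k, rfl⟩
      refine hy (Prime.dvd_of_dvd_pow (n := 2) (by norm_num : Prime (5 : ℤ)) ⟨x - 5 * (k : ℤ) ^ 2, ?_⟩)
      push_cast at hxy
      linarith
    refine ⟨hndvd, ?_⟩
    by_contra! hlt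
    interval_cases N
    · norm_num at hsize
    · norm_num at hsize
    · exact hrep ⟨4, by norm_num⟩
    · exact hrep ⟨3, by norm_num⟩
    · exact hndvd dvd_rfl
  · rintro ⟨hndvd, hN6⟩
    refine ⟨by nlinarith, ⟨(N : ℤ) ^ 2, 2 * N, ?_, ?_⟩, ?_⟩
    · omega
    · push_cast
      ring
    · rintro ⟨y, hy⟩
      push_cast at hy
      have hN6' : (6 : ℤ) ≤ N := by exact_mod_cast hN6
      nlinarith [sq_nonneg y]
end

section
/- For every positive natural number N, the square N² is excluded by the prime 13 if and only if 13 ∤ N, N ≥ 7, and N ≠ 12. (The squares 25 = 13² − 144 and 144 = 13² − 25 are exempted from the exclusion for p = 13, and squares not exceeding 42¼ are not subject to it.) -/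
theorem excludedBy_thirteen_iff (N : ℕ) (hN : 0 < N) :
    ExcludedBy 13 (N ^ 2) ↔ ¬ 13 ∣ N ∧ 7 ≤ N ∧ N ≠ 12 := by
  have prime_thirteen : Prime (13 : ℤ) := Int.prime_iff_natAbs_prime.mpr (by norm_num)
  unfold ExcludedBy
  push_cast
  constructor
  · rintro ⟨hlarge, ⟨x, y, hy, hxy⟩, hexempt⟩
    refine ⟨fun hdvd => hy ?_, by nlinarith, ?_⟩
    · obtain ⟨k, rfl⟩ := hdvd
      push_cast at hxy
      exact prime_thirteen.dvd_of_dvd_pow (n := 2) ⟨x - 13 * k ^ 2, by linarith⟩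
    · rintro rfl
      exact hexempt ⟨5, by norm_num⟩
  · rintro ⟨hdvd, hseven, htwelve⟩
    refine ⟨by nlinarith, ⟨2 * N ^ 2, 5 * N, by omega, by ring⟩, ?_⟩
    rintro ⟨y, hy⟩
    have hN_le : N ≤ 13 := by
      zify
      nlinarith [sq_nonneg y]
    have hy_le : y ≤ 13 := by nlinarith
    have hy_ge : -13 ≤ y := by nlinarith
    interval_cases N <;> first | omega | (interval_cases y <;> omega)
end

section
/- Let N be a natural number with N ≥ 6. If N² is excluded neither by the prime 5 nor by the prime 13, then 65 divides N. (After the exclusions for 5 and 13, the surviving squares beyond 25 are exactly 1, 4, 9, 16, 25, 65², 130², 195², 260², etc.) -/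
/-- If `p ∣ c ^ 2 + 1` and `p` is a prime not dividing `N`, then `y = c * N` witnesses that a
sufficiently large `N ^ 2` is excluded by `p`. -/
theorem excludedBy_sq {p N : ℕ} (hp : p.Prime) {c k : ℤ} (hc : c ^ 2 + 1 = p * k)
    (hN : ¬ p ∣ N) (hlt : p ^ 2 < 4 * N ^ 2)
    (hsum : ∀ y : ℤ, (N : ℤ) ^ 2 ≠ (p : ℤ) ^ 2 - y ^ 2) : ExcludedBy p (N ^ 2) := by
  have hp' : Prime (p : ℤ) := Nat.prime_iff_prime_int.mp hp
  refine ⟨hlt, ⟨k * N ^ 2, c * N, fun h => ?_, ?_⟩, ?_⟩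
  · rcases hp'.dvd_or_dvd h with h | h
    · have h_one : (p : ℤ) ∣ 1 :=
        (Int.dvd_add_right (dvd_pow h two_ne_zero)).mp ⟨k, hc⟩
      exact hp'.not_isUnit (isUnit_of_dvd_one h_one)
    · exact hN (Int.natCast_dvd_natCast.mp h)
  · push_cast
    linear_combination (N : ℤ) ^ 2 * hc
  · rintro ⟨y, hy⟩
    exact hsum y (by exact_mod_cast hy)

theorem sixtyfive_dvd_of_not_excluded (N : ℕ) (hN : 6 ≤ N)
    (h5 : ¬ ExcludedBy 5 (N ^ 2)) (h13 : ¬ ExcludedBy 13 (N ^ 2)) :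
    65 ∣ N := by
  have h_five : 5 ∣ N := by
    by_contra h
    refine h5 (excludedBy_sq (c := 2) (k := 1) (by norm_num) (by norm_num) h (by nlinarith) ?_)
    intro y hy
    push_cast at hy
    have : (6 : ℤ) ≤ N := by exact_mod_cast hN
    nlinarith [sq_nonneg y]
  have h_thirteen : 13 ∣ N := by
    by_contra h
    have h_ten : 10 ≤ N := by omega
    refine h13 (excludedBy_sq (c := 5) (k := 2) (by norm_num) (by norm_num) h (by nlinarith) ?_)
    intro y hy
    push_cast at hy
    have h_le : N ≤ 13 := by
      have : (N : ℤ) ≤ 13 := by nlinarith [sq_nonneg y]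
      exact_mod_cast this
    obtain rfl : N = 10 := by omega
    norm_num at hy
    have h_lt : y < 9 := by nlinarith
    have h_gt : -9 < y := by nlinarith
    interval_cases y <;> norm_num at hy
  exact Nat.Coprime.mul_dvd_of_dvd_of_dvd (by norm_num : Nat.Coprime 5 13) h_five h_thirteen
end

section
/- Let N be a natural number with N ≥ 6. If N² is excluded by none of the primes 5, 13 and 17, then 1105 = 5·13·17 divides N. (After these three exclusions, the first surviving square beyond 25 is 1105².) -/
theorem dvd_of_not_excludedBy_sq {p N : ℕ} (hp : p.Prime) {i : ℤ} (hi : (p : ℤ) ∣ i ^ 2 + 1)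
    (hN : p < 2 * N) (hy : ¬ ∃ y : ℤ, ((N ^ 2 : ℕ) : ℤ) = (p : ℤ) ^ 2 - y ^ 2)
    (h : ¬ ExcludedBy p (N ^ 2)) : p ∣ N := by
  by_contra hpN
  have hp' : Prime (p : ℤ) := Nat.prime_iff_prime_int.mp hp
  obtain ⟨k, hk⟩ := hi
  refine h ⟨by nlinarith, ⟨k * N ^ 2, i * N, fun hd => ?_, ?_⟩, hy⟩
  · rcases hp'.dvd_or_dvd hd with hd | hd
    · refine hp'.not_isUnit (isUnit_of_dvd_one ?_)
      have h1 : (1 : ℤ) = p * k - i * i := by linear_combination hk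
      rw [h1]
      exact dvd_sub (dvd_mul_right _ _) (hd.mul_left i)
    · exact hpN (Int.natCast_dvd_natCast.mp hd)
  · push_cast
    linear_combination (N : ℤ) ^ 2 * hk

theorem not_exists_sq_eq_sq_sub_sq_of_lt {p N : ℕ} (h : p < N) :
    ¬ ∃ y : ℤ, ((N ^ 2 : ℕ) : ℤ) = (p : ℤ) ^ 2 - y ^ 2 := by
  rintro ⟨y, hy⟩
  push_cast at hy
  have h' : (p : ℤ) < N := by exact_mod_cast h
  nlinarith [sq_nonneg y]

theorem elevenhundredfive_dvd_of_not_excluded (N : ℕ) (hN : 6 ≤ N)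
    (h5 : ¬ ExcludedBy 5 (N ^ 2)) (h13 : ¬ ExcludedBy 13 (N ^ 2))
    (h17 : ¬ ExcludedBy 17 (N ^ 2)) :
    1105 ∣ N := by
  have d5 : 5 ∣ N := dvd_of_not_excludedBy_sq (by norm_num) (i := 2) (by norm_num) (by lia)
    (not_exists_sq_eq_sq_sub_sq_of_lt (by lia)) h5
  have d13 : 13 ∣ N := by
    refine dvd_of_not_excludedBy_sq (by norm_num) (i := 5) (by norm_num) (by lia) ?_ h13
    rcases (show N = 10 ∨ 13 < N by lia) with rfl | hlt
    · rintro ⟨y, hy⟩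
      norm_num at hy
      have h1 : y < 9 := by nlinarith
      have h2 : -9 < y := by nlinarith
      interval_cases y <;> lia
    · exact not_exists_sq_eq_sq_sub_sq_of_lt hlt
  have d17 : 17 ∣ N := dvd_of_not_excludedBy_sq (by norm_num) (i := 4) (by norm_num) (by lia)
    (not_exists_sq_eq_sq_sub_sq_of_lt (by lia)) h17
  lia
end
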